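/- arXiv:quant-ph/0611020 — 2 statements merged into one kernel-verified Lean document; each statement's English description precedes it below -/
import Mathlib

section
/- Define the Carlitz Bessel polynomials by p_0(x) = 1 and, for n ≥ 1, p_n(x) = Σ_{k=1}^{n} ((2n-k-1)! / ((k-1)! (n-k)! 2^{n-k})) x^k. Then for every integer n ≥ 0, every real θ_c > 0 and every complex c ≠ 0, ∫_{-θ_c}^{θ_c} e^{cθ} θ (θ_c² - θ²)^n dθ = (2^n n! (-1)^n / (c^{2n+3} θ_c)) · (p_{n+2}(-c θ_c) e^{c θ_c} + p_{n+2}(c θ_c) e^{-c θ_c}). -/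
open Complex Finset

/-- The Carlitz Bessel polynomials:
`p_0(x) = 1` and `p_n(x) = Σ_{k=1}^n ((2n-k-1)!/((k-1)!(n-k)! 2^{n-k})) x^k` for `n ≥ 1`. -/
noncomputable def carlitzBesselP (n : ℕ) (x : ℂ) : ℂ :=
  if n = 0 then 1 else
    ∑ k ∈ Finset.Icc 1 n,
      ((Nat.factorial (2 * n - k - 1) : ℂ) /
        ((Nat.factorial (k - 1) : ℂ) * (Nat.factorial (n - k) : ℂ) * 2 ^ (n - k))) * x ^ k


noncomputable def cbCoeff (n j : ℕ) : ℂ :=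
  if j ≤ n then (Nat.factorial (2 * n - j) : ℂ) /
    ((Nat.factorial j : ℂ) * (Nat.factorial (n - j) : ℂ) * 2 ^ (n - j)) else 0

theorem cb_eq_sum (n : ℕ) (x : ℂ) :
    carlitzBesselP (n + 1) x = ∑ j ∈ Finset.range (n + 1), cbCoeff n j * x ^ (j + 1) := by
  unfold carlitzBesselP
  rw [if_neg (Nat.succ_ne_zero n), ← Finset.Ico_add_one_right_eq_Icc, Finset.sum_Ico_eq_sum_range]
  apply Finset.sum_congr (by simp)
  intro j hj
  have hj' : j ≤ n := by
    have := Finset.mem_range.mp hj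
    omega
  unfold cbCoeff
  rw [if_pos hj']
  have h1 : 2 * (n + 1) - (1 + j) - 1 = 2 * n - j := by omega
  have h2 : 1 + j - 1 = j := by omega
  have h3 : n + 1 - (1 + j) = n - j := by omega
  rw [h1, h2, h3, add_comm 1 j]

theorem cbCoeff_zero (n : ℕ) : cbCoeff (n + 2) 0 = (2 * n + 3) * cbCoeff (n + 1) 0 := by
  unfold cbCoeff
  simp only [Nat.zero_le, if_true, Nat.sub_zero, Nat.factorial_zero]
  have h : 2 * (n + 2) = 2 * (n + 1) + 1 + 1 := by ring
  rw [h, Nat.factorial_succ, Nat.factorial_succ, Nat.factorial_succ (n + 1)]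
  have h2 : (Nat.factorial (n + 1) : ℂ) ≠ 0 := by exact_mod_cast Nat.factorial_ne_zero _
  have h3 : (n : ℂ) + 1 + 1 ≠ 0 := by exact_mod_cast Nat.succ_ne_zero (n + 1)
  push_cast
  field_simp
  ring

theorem cbCoeff_one (n : ℕ) : cbCoeff (n + 2) 1 = (2 * n + 3) * cbCoeff (n + 1) 1 := by
  unfold cbCoeff
  rw [if_pos (by omega), if_pos (by omega)]
  have e1 : 2 * (n + 2) - 1 = 2 * n + 1 + 1 + 1 := by omega
  have e2 : 2 * (n + 1) - 1 = 2 * n + 1 := by omega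
  have e3 : n + 2 - 1 = n + 1 := by omega
  have e4 : n + 1 - 1 = n := by omega
  rw [e1, e2, e3, e4, Nat.factorial_succ (2 * n + 1 + 1), Nat.factorial_succ (2 * n + 1),
    Nat.factorial_succ n]
  have h2 : (Nat.factorial n : ℂ) ≠ 0 := by exact_mod_cast Nat.factorial_ne_zero _
  have h3 : (n : ℂ) + 1 ≠ 0 := by exact_mod_cast Nat.succ_ne_zero n
  simp only [Nat.factorial_one]
  push_cast
  field_simp
  ring

theorem cbCoeff_add_two (n k : ℕ) (hk : k ≤ n) :
    cbCoeff (n + 2) (k + 2) = (2 * n + 3) * cbCoeff (n + 1) (k + 2) + cbCoeff n k := by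
  have hkf : (Nat.factorial k : ℂ) ≠ 0 := by exact_mod_cast Nat.factorial_ne_zero _
  have h3 : (k : ℂ) + 1 ≠ 0 := by exact_mod_cast Nat.succ_ne_zero k
  have h4 : (k : ℂ) + 1 + 1 ≠ 0 := by exact_mod_cast Nat.succ_ne_zero (k + 1)
  obtain ⟨m, rfl⟩ := Nat.exists_eq_add_of_le hk
  unfold cbCoeff
  rw [if_pos (show k + 2 ≤ k + m + 2 by omega), if_pos (show k ≤ k + m by omega)]
  have e1 : 2 * (k + m + 2) - (k + 2) = 2 * (k + m) - k + 1 + 1 := by omega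
  have e2 : k + m + 2 - (k + 2) = m := by omega
  have e3 : k + m - k = m := by omega
  rw [e1, e2, e3]
  rcases m with _ | m
  · rw [if_neg (by omega)]
    have e5 : 2 * (k + 0) - k = k := by omega
    rw [e5, Nat.factorial_succ (k + 1), Nat.factorial_succ k]
    push_cast
    field_simp
    simp
  · rw [if_pos (by omega)]
    have e5 : 2 * (k + (m + 1)) - k = k + 2 * m + 2 := by omega
    have e6 : 2 * (k + (m + 1) + 1) - (k + 2) = k + 2 * m + 2 := by omega
    have e7 : k + (m + 1) + 1 - (k + 2) = m := by omega
    rw [e5, e6, e7, Nat.factorial_succ (k + 2 * m + 2 + 1), Nat.factorial_succ (k + 2 * m + 2),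
      Nat.factorial_succ (k + 1), Nat.factorial_succ k, Nat.factorial_succ m]
    have hm : (Nat.factorial m : ℂ) ≠ 0 := by exact_mod_cast Nat.factorial_ne_zero _
    have h5 : (m : ℂ) + 1 ≠ 0 := by exact_mod_cast Nat.succ_ne_zero m
    push_cast
    field_simp
    ring

theorem cb_rec (n : ℕ) (x : ℂ) :
    carlitzBesselP (n + 3) x =
      (2 * n + 3) * carlitzBesselP (n + 2) x + x ^ 2 * carlitzBesselP (n + 1) x := by
  have h2 : carlitzBesselP (n + 2) x =
      ∑ j ∈ Finset.range (n + 3), cbCoeff (n + 1) j * x ^ (j + 1) := by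
    rw [Finset.sum_range_succ, cb_eq_sum (n + 1)]
    have : cbCoeff (n + 1) (n + 2) = 0 := by
      unfold cbCoeff
      rw [if_neg (by omega)]
    rw [this]
    simp
  rw [h2, cb_eq_sum (n + 2), cb_eq_sum n, Finset.sum_range_succ', Finset.sum_range_succ',
    Finset.sum_range_succ' _ (n + 2), Finset.sum_range_succ' _ (n + 1)]
  have : ∑ k ∈ Finset.range (n + 1), cbCoeff (n + 2) (k + 1 + 1) * x ^ (k + 1 + 1 + 1) =
      (2 * n + 3) * ∑ k ∈ Finset.range (n + 1), cbCoeff (n + 1) (k + 1 + 1) * x ^ (k + 1 + 1 + 1)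
       + x ^ 2 * ∑ k ∈ Finset.range (n + 1), cbCoeff n k * x ^ (k + 1) := by
    rw [Finset.mul_sum, Finset.mul_sum, ← Finset.sum_add_distrib]
    apply Finset.sum_congr rfl
    intro k hk
    rw [cbCoeff_add_two n k (by have := Finset.mem_range.mp hk; omega)]
    ring
  rw [this, cbCoeff_zero, zero_add, cbCoeff_one]
  ring

theorem cb_two (x : ℂ) : carlitzBesselP 2 x = x + x ^ 2 := by
  rw [cb_eq_sum 1]
  simp [Finset.sum_range_succ, cbCoeff]

theorem cb_three (x : ℂ) : carlitzBesselP 3 x = 3 * x + 3 * x ^ 2 + x ^ 3 := by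
  rw [cb_rec 0, cb_two, cb_eq_sum 0]
  simp [cbCoeff]
  ring

/-- The integral. -/
noncomputable def cbI (T : ℝ) (c : ℂ) (n : ℕ) : ℂ :=
  ∫ θ in (-T)..T, Complex.exp (c * θ) * ((θ : ℂ) * ((T : ℂ) ^ 2 - (θ : ℂ) ^ 2) ^ n)

theorem cb_ii (T : ℝ) (c : ℂ) (n : ℕ) : IntervalIntegrable
    (fun θ : ℝ => Complex.exp (c * θ) * ((θ : ℂ) * ((T : ℂ) ^ 2 - (θ : ℂ) ^ 2) ^ n))
    MeasureTheory.volume (-T) T := by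
  apply Continuous.intervalIntegrable
  fun_prop

theorem cb_exp_deriv (c : ℂ) (θ : ℝ) :
    HasDerivAt (fun t : ℝ => Complex.exp (c * t)) (Complex.exp (c * θ) * c) θ := by
  have h : HasDerivAt (fun t : ℝ => c * (t : ℂ)) (c * 1) θ :=
    (Complex.ofRealCLM.hasDerivAt (x := θ)).const_mul c
  simpa using h.cexp

theorem cb_id_deriv (θ : ℝ) : HasDerivAt (fun t : ℝ => (t : ℂ)) 1 θ :=
  Complex.ofRealCLM.hasDerivAt (x := θ)

theorem cb_w_deriv (T θ : ℝ) :
    HasDerivAt (fun t : ℝ => (T : ℂ) ^ 2 - (t : ℂ) ^ 2) (-(2 * (θ : ℂ))) θ := by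
  have := ((cb_id_deriv θ).pow 2).const_sub ((T : ℂ) ^ 2)
  simpa using this

theorem cbI_zero (T : ℝ) (c : ℂ) (hc : c ≠ 0) :
    cbI T c 0 = Complex.exp (c * T) * (T / c - 1 / c ^ 2)
      + Complex.exp (-(c * T)) * (T / c + 1 / c ^ 2) := by
  have key := intervalIntegral.integral_eq_sub_of_hasDerivAt (a := -T) (b := T)
    (f := fun t : ℝ => Complex.exp (c * t) * ((t : ℂ) / c - 1 / c ^ 2))
    (f' := fun θ : ℝ => Complex.exp (c * θ) * ((θ : ℂ) * ((T : ℂ) ^ 2 - (θ : ℂ) ^ 2) ^ 0))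
    (by
      intro θ _
      have := (cb_exp_deriv c θ).mul (((cb_id_deriv θ).div_const c).sub_const (1 / c ^ 2))
      refine this.congr_deriv ?_
      field_simp
      ring) (cb_ii T c 0)
  unfold cbI
  rw [key]
  push_cast
  rw [show c * -(T : ℂ) = -(c * T) by ring]
  ring

theorem cbI_one (T : ℝ) (c : ℂ) :
    c ^ 2 * cbI T c 1 + 6 * cbI T c 0 =
      2 * T ^ 2 * (Complex.exp (c * T) - Complex.exp (-(c * T))) := by
  have key := intervalIntegral.integral_eq_sub_of_hasDerivAt (a := -T) (b := T)
    (f := fun t : ℝ => Complex.exp (c * t) *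
      (c * ((t : ℂ) * ((T : ℂ) ^ 2 - (t : ℂ) ^ 2)) -
        (((T : ℂ) ^ 2 - (t : ℂ) ^ 2) - 2 * (t : ℂ) ^ 2)))
    (f' := fun θ : ℝ =>
      c ^ 2 * (Complex.exp (c * θ) * ((θ : ℂ) * ((T : ℂ) ^ 2 - (θ : ℂ) ^ 2) ^ 1)) +
      6 * (Complex.exp (c * θ) * ((θ : ℂ) * ((T : ℂ) ^ 2 - (θ : ℂ) ^ 2) ^ 0)))
    (by
      intro θ _
      have := (cb_exp_deriv c θ).mul
        ((((cb_id_deriv θ).mul (cb_w_deriv T θ)).const_mul c).sub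
          ((cb_w_deriv T θ).sub (((cb_id_deriv θ).pow 2).const_mul 2)))
      refine this.congr_deriv ?_
      simp
      ring) (((cb_ii T c 1).const_mul _).add ((cb_ii T c 0).const_mul _))
  rw [intervalIntegral.integral_add ((cb_ii T c 1).const_mul _) ((cb_ii T c 0).const_mul _),
    intervalIntegral.integral_const_mul, intervalIntegral.integral_const_mul] at key
  unfold cbI
  rw [key]
  push_cast
  rw [show c * -(T : ℂ) = -(c * T) by ring]
  ring

theorem cbI_rec (T : ℝ) (c : ℂ) (n : ℕ) :
    c ^ 2 * cbI T c (n + 2) + (2 * (n + 2) * (2 * n + 5)) * cbI T c (n + 1)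
      + (-(4 * (n + 2) * (n + 1) * T ^ 2)) * cbI T c n = 0 := by
  have i1 := (cb_ii T c (n + 2)).const_mul (c ^ 2)
  have i2 := (cb_ii T c (n + 1)).const_mul ((2 * (n + 2) * (2 * n + 5) : ℂ))
  have i3 := (cb_ii T c n).const_mul (-(4 * (n + 2) * (n + 1) * T ^ 2) : ℂ)
  have key := intervalIntegral.integral_eq_sub_of_hasDerivAt (a := -T) (b := T)
    (f := fun t : ℝ => Complex.exp (c * t) *
      (c * ((t : ℂ) * ((T : ℂ) ^ 2 - (t : ℂ) ^ 2) ^ (n + 2)) -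
        (((T : ℂ) ^ 2 - (t : ℂ) ^ 2) ^ (n + 2) -
          2 * (n + 2) * ((t : ℂ) ^ 2 * ((T : ℂ) ^ 2 - (t : ℂ) ^ 2) ^ (n + 1)))))
    (f' := fun θ : ℝ =>
      c ^ 2 * (Complex.exp (c * θ) * ((θ : ℂ) * ((T : ℂ) ^ 2 - (θ : ℂ) ^ 2) ^ (n + 2))) +
      (2 * (n + 2) * (2 * n + 5) : ℂ) *
        (Complex.exp (c * θ) * ((θ : ℂ) * ((T : ℂ) ^ 2 - (θ : ℂ) ^ 2) ^ (n + 1))) +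
      (-(4 * (n + 2) * (n + 1) * T ^ 2) : ℂ) *
        (Complex.exp (c * θ) * ((θ : ℂ) * ((T : ℂ) ^ 2 - (θ : ℂ) ^ 2) ^ n)))
    (by
      intro θ _
      have := (cb_exp_deriv c θ).mul
        ((((cb_id_deriv θ).mul ((cb_w_deriv T θ).pow (n + 2))).const_mul c).sub
          (((cb_w_deriv T θ).pow (n + 2)).sub
            ((((cb_id_deriv θ).pow 2).mul ((cb_w_deriv T θ).pow (n + 1))).const_mul
              (2 * (n + 2) : ℂ))))
      refine this.congr_deriv ?_
      have e1 : n + 2 - 1 = n + 1 := rfl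
      have e2 : n + 1 - 1 = n := rfl
      simp only [Pi.mul_apply, Pi.pow_apply, Pi.sub_apply, e1, e2]
      push_cast
      ring) ((i1.add i2).add i3)
  rw [intervalIntegral.integral_add (i1.add i2) i3, intervalIntegral.integral_add i1 i2,
    intervalIntegral.integral_const_mul, intervalIntegral.integral_const_mul,
    intervalIntegral.integral_const_mul] at key
  unfold cbI
  rw [key]
  push_cast
  simp

theorem cbI_eq (T : ℝ) (hT : 0 < T) (c : ℂ) (hc : c ≠ 0) (n : ℕ) :
    cbI T c n = (2 ^ n * (Nat.factorial n : ℂ) * (-1) ^ n / (c ^ (2 * n + 3) * T)) *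
        (carlitzBesselP (n + 2) (-(c * T)) * Complex.exp (c * T) +
          carlitzBesselP (n + 2) (c * T) * Complex.exp (-(c * T))) := by
  have hT' : (T : ℂ) ≠ 0 := by exact_mod_cast hT.ne'
  have hc2 : c ^ 2 ≠ 0 := pow_ne_zero 2 hc
  induction n using Nat.twoStepInduction with
  | zero =>
    rw [cbI_zero T c hc, cb_two, cb_two]
    simp only [Nat.factorial_zero]
    field_simp
    push_cast
    ring
  | one =>
    have h := cbI_one T c
    rw [cbI_zero T c hc] at h
    rw [cb_three, cb_three]
    apply mul_left_cancel₀ hc2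
    rw [eq_sub_of_add_eq h]
    simp only [Nat.factorial_one]
    field_simp
    push_cast
    ring
  | more n ih1 ih2 =>
    have h := cbI_rec T c n
    rw [ih1, ih2] at h
    apply mul_left_cancel₀ hc2
    have h' := eq_neg_of_add_eq_zero_left h
    rw [eq_sub_of_add_eq h']
    have r1 := cb_rec (n + 1) (-(c * T))
    have r2 := cb_rec (n + 1) (c * T)
    rw [show n + 1 + 3 = n + 2 + 2 by ring, show n + 1 + 2 = n + 1 + 2 by ring,
      show n + 1 + 1 = n + 2 by ring] at r1 r2
    rw [r1, r2, Nat.factorial_succ (n + 1), Nat.factorial_succ n]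
    push_cast
    have p1 : c ^ (2 * n + 3) ≠ 0 := pow_ne_zero _ hc
    rw [show 2 * (n + 2) + 3 = (2 * n + 3) + 4 by ring,
      show 2 * (n + 1) + 3 = (2 * n + 3) + 2 by ring, pow_add c _ 4, pow_add c _ 2]
    generalize c ^ (2 * n + 3) = d at *
    field_simp
    ring

/-- Evaluation of `∫_{-θ_c}^{θ_c} e^{cθ} θ (θ_c² - θ²)^n dθ` in
terms of Carlitz Bessel polynomials. -/
theorem integral_exp_mul_sq_pow_eq_carlitzBesselP
    (n : ℕ) (θc : ℝ) (hθc : 0 < θc) (c : ℂ) (hc : c ≠ 0) :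
    ∫ θ in (-θc)..θc, Complex.exp (c * θ) * (θ : ℂ) * ((θc ^ 2 - θ ^ 2 : ℝ) ^ n : ℂ) =
      (2 ^ n * (Nat.factorial n : ℂ) * (-1) ^ n / (c ^ (2 * n + 3) * θc)) *
        (carlitzBesselP (n + 2) (-(c * θc)) * Complex.exp (c * θc) +
          carlitzBesselP (n + 2) (c * θc) * Complex.exp (-(c * θc))) := by
  rw [← cbI_eq θc hθc c hc n]
  unfold cbI
  congr 1
  ext θ
  push_cast
  ring
end

section
/- Define the Carlitz Bessel polynomials by p_0(x) = 1 and, for n ≥ 1, p_n(x) = Σ_{k=1}^{n} ((2n-k-1)! / ((k-1)! (n-k)! 2^{n-k})) x^k. For a complex number c ≠ 0 and integer n ≥ 0, define g_n(θ) = -(p_{n+1}(-cθ)/(cθ)) · ((-1)^n / c^{2n}) · e^{cθ} for θ ≠ 0, extended continuously to θ = 0 (this is well defined since x divides the polynomial p_{n+1}(x)). Then g_0(θ) = e^{cθ} for all real θ, and for every integer n ≥ 0 and every real θ, the derivative of g_{n+1} satisfies g_{n+1}'(θ) = θ · g_n(θ). -/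
open Complex Finset

/-- Coefficients of `p_{n+1}(x)/x`. -/
noncomputable def cbA (n j : ℕ) : ℂ :=
  if j ≤ n then (Nat.factorial (2 * n - j) : ℂ) /
    ((Nat.factorial j : ℂ) * (Nat.factorial (n - j) : ℂ) * 2 ^ (n - j)) else 0

/-- The polynomial function `p_{n+1}(x)/x`. -/
noncomputable def cbQ (n : ℕ) (x : ℂ) : ℂ := ∑ j ∈ Finset.range (n + 1), cbA n j * x ^ j

lemma cbP_eq (n : ℕ) (x : ℂ) : carlitzBesselP (n + 1) x = x * cbQ n x := by
  unfold carlitzBesselP cbQ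
  rw [if_neg (Nat.succ_ne_zero n), Finset.mul_sum]
  symm
  refine Finset.sum_bij (fun j _ => j + 1) ?_ ?_ ?_ ?_
  · intro j hj
    simp at hj ⊢
    omega
  · intro a _ b _ h
    omega
  · intro b hb
    simp at hb
    exact ⟨b - 1, by simp; omega, by omega⟩
  · intro j hj
    simp at hj
    have h1 : 2 * (n + 1) - (j + 1) - 1 = 2 * n - j := by omega
    have h2 : n + 1 - (j + 1) = n - j := by omega
    rw [h1, h2, cbA, if_pos (by omega), Nat.add_sub_cancel]
    ring

lemma cbA_rec (n j : ℕ) (hj : j ≤ n) :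
    cbA (n + 1) (j + 1) - (j + 2) * cbA (n + 1) (j + 2) = cbA n j := by
  unfold cbA
  rcases hj.eq_or_lt with rfl | h
  · have h1 : 2 * (j + 1) - (j + 1) = j + 1 := by omega
    have h2 : 2 * j - j = j := by omega
    have := Nat.factorial_ne_zero j
    have := Nat.factorial_ne_zero (j + 1)
    simp [h1, h2]
    field_simp
  · obtain ⟨m, rfl⟩ := Nat.exists_eq_add_of_lt h
    rw [if_pos (by omega), if_pos (by omega), if_pos (by omega)]
    have h1 : 2 * (j + m + 1 + 1) - (j + 1) = j + 2 * m + 2 + 1 := by omega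
    have h2 : 2 * (j + m + 1 + 1) - (j + 2) = j + 2 * m + 2 := by omega
    have h3 : 2 * (j + m + 1) - j = j + 2 * m + 2 := by omega
    have h4 : j + m + 1 + 1 - (j + 1) = m + 1 := by omega
    have h5 : j + m + 1 + 1 - (j + 2) = m := by omega
    have h6 : j + m + 1 - j = m + 1 := by omega
    rw [h1, h2, h3, h4, h5, h6, Nat.factorial_succ (j + 2 * m + 2), Nat.factorial_succ (j + 1),
      Nat.factorial_succ j, Nat.factorial_succ m]
    have a1 : (Nat.factorial j : ℂ) ≠ 0 := by exact_mod_cast Nat.factorial_ne_zero j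
    have a2 : (Nat.factorial m : ℂ) ≠ 0 := by exact_mod_cast Nat.factorial_ne_zero m
    have a3 : (j : ℂ) + 1 ≠ 0 := by exact_mod_cast Nat.succ_ne_zero j
    have a4 : (m : ℂ) + 1 ≠ 0 := by exact_mod_cast Nat.succ_ne_zero m
    have a5 : (j : ℂ) + 1 + 1 ≠ 0 := by exact_mod_cast Nat.succ_ne_zero (j + 1)
    push_cast
    field_simp
    ring

lemma cbA_zero (n : ℕ) : cbA (n + 1) 0 = cbA (n + 1) 1 := by
  unfold cbA
  have h1 : 2 * (n + 1) - 0 = 2 * n + 1 + 1 := by omega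
  have h2 : 2 * (n + 1) - 1 = 2 * n + 1 := by omega
  have h3 : n + 1 - 0 = n + 1 := by omega
  have h4 : n + 1 - 1 = n := by omega
  rw [if_pos (by omega), if_pos (by omega), h1, h2, h3, h4, Nat.factorial_succ (2 * n + 1),
    Nat.factorial_succ n]
  have a2 : (Nat.factorial n : ℂ) ≠ 0 := by exact_mod_cast Nat.factorial_ne_zero n
  have a4 : (n : ℂ) + 1 ≠ 0 := by exact_mod_cast Nat.succ_ne_zero n
  simp only [Nat.factorial_zero, Nat.factorial_one]
  push_cast
  field_simp
  ring

lemma cbQ_hasDerivAt (n : ℕ) (x : ℂ) :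
    HasDerivAt (cbQ (n + 1)) (cbQ (n + 1) x - x * cbQ n x) x := by
  have h : HasDerivAt (cbQ (n + 1))
      (∑ j ∈ Finset.range (n + 1 + 1), cbA (n + 1) j * ((j : ℂ) * x ^ (j - 1))) x := by
    unfold cbQ
    exact HasDerivAt.fun_sum fun j _ => (hasDerivAt_pow j x).const_mul _
  convert h using 1
  have e : ∑ j ∈ Finset.range (n + 1 + 1), cbA (n + 1) j * ((j : ℂ) * x ^ (j - 1))
      = ∑ j ∈ Finset.range (n + 1 + 1 + 1), cbA (n + 1) j * ((j : ℂ) * x ^ (j - 1)) := by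
    rw [Finset.sum_range_succ _ (n + 1 + 1)]
    simp [cbA]
  rw [e, Finset.sum_range_succ', Finset.sum_range_succ']
  unfold cbQ
  rw [Finset.sum_range_succ', Finset.mul_sum, cbA_zero]
  have e2 : ∑ j ∈ Finset.range (n + 1), x * (cbA n j * x ^ j) =
      ∑ j ∈ Finset.range (n + 1), cbA (n + 1) (j + 1) * x ^ (j + 1) -
      ∑ j ∈ Finset.range (n + 1), cbA (n + 1) (j + 1 + 1) *
        (((j + 1 + 1 : ℕ) : ℂ) * x ^ (j + 1 + 1 - 1)) := by
    rw [← Finset.sum_sub_distrib]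
    refine Finset.sum_congr rfl fun j hj => ?_
    rw [← cbA_rec n j (by have := Finset.mem_range.1 hj; omega)]
    simp only [Nat.add_sub_cancel]
    push_cast
    ring
  rw [e2]
  simp
  ring

/-- For `c ≠ 0`, the functions
`g_n(θ) = -(p_{n+1}(-cθ)/(cθ)) ((-1)^n/c^{2n}) e^{cθ}` (for `θ ≠ 0`, extended
continuously to `θ = 0`) satisfy `g_0(θ) = e^{cθ}` and `g_{n+1}'(θ) = θ g_n(θ)`. -/
theorem carlitzBesselP_iterated_antiderivatives
    (c : ℂ) (hc : c ≠ 0) (g : ℕ → ℝ → ℂ)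
    (hg_cont : ∀ n : ℕ, Continuous (g n))
    (hg : ∀ n : ℕ, ∀ θ : ℝ, θ ≠ 0 → g n θ =
      -(carlitzBesselP (n + 1) (-(c * θ)) / (c * θ)) * ((-1) ^ n / c ^ (2 * n)) *
        Complex.exp (c * θ)) :
    (∀ θ : ℝ, g 0 θ = Complex.exp (c * θ)) ∧
      ∀ n : ℕ, ∀ θ : ℝ, deriv (g (n + 1)) θ = θ * g n θ := by
  have key : ∀ n : ℕ, g n = fun θ : ℝ =>
      cbQ n (-(c * θ)) * ((-1) ^ n / c ^ (2 * n)) * Complex.exp (c * θ) := by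
    intro n
    refine Continuous.ext_on (dense_compl_singleton (0 : ℝ)) (hg_cont n) ?_ ?_
    · unfold cbQ
      fun_prop
    · intro θ hθ
      have hθ' : θ ≠ 0 := hθ
      have hz : (θ : ℂ) ≠ 0 := by exact_mod_cast hθ'
      simp only [hg n θ hθ', cbP_eq]
      congr 2
      field_simp
  refine ⟨fun θ => ?_, fun n θ => ?_⟩
  · rw [key]
    simp [cbQ, cbA]
  · rw [key, key]
    have hl : HasDerivAt (fun t : ℝ => c * (t : ℂ)) c θ := by
      simpa using (Complex.ofRealCLM.hasDerivAt (x := θ)).const_mul c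
    have hq := (cbQ_hasDerivAt n (-(c * θ))).comp θ hl.neg
    have := ((hq.mul_const ((-1) ^ (n + 1) / c ^ (2 * (n + 1)))).mul hl.cexp).deriv
    refine Eq.trans this ?_
    simp only [Function.comp, Pi.neg_apply]
    field_simp
    ring
end
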